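/- arXiv:2207.01999 — 2 statements merged into one kernel-verified Lean document; each statement's English description precedes it below -/
import Mathlib

section
/- For all integers i ≠ j one has a_i a_j† = 0, and for every integer i and every vector ξ in the monotone Fock space F, the series Σ_{k ≤ i} a_k† a_k ξ (summed over all integers k ≤ i) converges in F and a_i a_i† ξ = ξ − Σ_{k ≤ i} a_k† a_k ξ; that is, a_i a_j† = δ_{i,j}(I − Σ_{k ≤ i} a_k† a_k), with convergence in the strong operator topology. -/
noncomputable section

open ContinuousLinearMap

/-- The discrete monotone Fock space: `ℓ²` over the finite subsets of `ℤ`. -/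
abbrev MF : Type := lp (fun _ : Finset ℤ => ℂ) 2

/-- The canonical orthonormal basis vector corresponding to a finite subset `S ⊆ ℤ`;
`eS ∅` is the vacuum vector `Ω`. -/
noncomputable def eS (S : Finset ℤ) : MF := lp.single 2 S 1

/-- `a : ℤ → MF →L[ℂ] MF` is the family of monotone annihilation operators:
`a i (eS S) = eS (S \ {i})` if `S` is nonempty with `min S = i`, and `a i (eS S) = 0`
otherwise.  The creation operator `a_i†` is the Hilbert-space adjoint of `a i`. -/
def IsMonotoneAnnihilation (a : ℤ → MF →L[ℂ] MF) : Prop :=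
  ∀ (i : ℤ) (S : Finset ℤ),
    (S.min = (i : WithBot ℤ) → a i (eS S) = eS (S.erase i)) ∧
    (S.min ≠ (i : WithBot ℤ) → a i (eS S) = 0)

theorem IsMonotoneAnnihilation.apply_of_isLeast {a : ℤ → MF →L[ℂ] MF}
    (ha : IsMonotoneAnnihilation a) {i : ℤ} {S : Finset ℤ} (h : IsLeast (S : Set ℤ) i) :
    a i (eS S) = eS (S.erase i) :=
  (ha i S).1 (le_antisymm (Finset.min_le h.1)
    (Finset.le_min fun _ ht => WithTop.coe_le_coe.2 (h.2 ht)))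

theorem IsMonotoneAnnihilation.apply_of_not_isLeast {a : ℤ → MF →L[ℂ] MF}
    (ha : IsMonotoneAnnihilation a) {i : ℤ} {S : Finset ℤ} (h : ¬ IsLeast (S : Set ℤ) i) :
    a i (eS S) = 0 :=
  (ha i S).2 fun hS => h ⟨Finset.mem_of_min hS, fun _ ht => Finset.min_le_of_eq ht hS⟩

theorem inner_eS_left (S : Finset ℤ) (ξ : MF) : inner ℂ (eS S) ξ = ξ S := by
  simp [eS, lp.inner_single_left]

theorem eS_apply (S T : Finset ℤ) : eS S T = if T = S then 1 else 0 := by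
  simp [eS, lp.single_apply, Pi.single_apply]

theorem IsMonotoneAnnihilation.adjoint_apply_of_lt {a : ℤ → MF →L[ℂ] MF}
    (ha : IsMonotoneAnnihilation a) {i : ℤ} {S : Finset ℤ} (h : ∀ t ∈ S, i < t) :
    adjoint (a i) (eS S) = eS (insert i S) := by
  have hi : i ∉ S := fun hS => lt_irrefl _ (h i hS)
  ext T
  rw [← inner_eS_left T, adjoint_inner_right, eS_apply]
  by_cases hT : IsLeast (T : Set ℤ) i
  · rw [ha.apply_of_isLeast hT, inner_eS_left, eS_apply]
    have hiT : i ∈ T := hT.1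
    congr 1
    rw [eq_iff_iff]
    constructor
    · rintro rfl
      exact (Finset.insert_erase hiT).symm
    · rintro rfl
      exact Finset.erase_insert hi
  · rw [ha.apply_of_not_isLeast hT, inner_zero_left, if_neg]
    rintro rfl
    refine hT ⟨by simp, fun t ht => ?_⟩
    rcases Finset.mem_insert.1 (Finset.mem_coe.1 ht) with rfl | ht
    exacts [le_rfl, (h t ht).le]

theorem IsMonotoneAnnihilation.adjoint_apply_of_not_lt {a : ℤ → MF →L[ℂ] MF}
    (ha : IsMonotoneAnnihilation a) {i : ℤ} {S : Finset ℤ} (h : ¬ ∀ t ∈ S, i < t) :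
    adjoint (a i) (eS S) = 0 := by
  ext T
  rw [← inner_eS_left T, adjoint_inner_right]
  by_cases hT : IsLeast (T : Set ℤ) i
  · rw [ha.apply_of_isLeast hT, inner_eS_left, eS_apply, if_neg]
    · rfl
    rintro rfl
    refine h fun t ht => ?_
    rw [Finset.mem_erase] at ht
    exact lt_of_le_of_ne (hT.2 ht.2) ht.1.symm
  · rw [ha.apply_of_not_isLeast hT, inner_zero_left]
    rfl

open Classical in
theorem IsMonotoneAnnihilation.adjoint_apply_self_apply {a : ℤ → MF →L[ℂ] MF}
    (ha : IsMonotoneAnnihilation a) (k : ℤ) (ξ : MF) (S : Finset ℤ) :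
    adjoint (a k) (a k ξ) S = if IsLeast (S : Set ℤ) k then ξ S else 0 := by
  rw [← inner_eS_left S, adjoint_inner_right, ← adjoint_inner_left]
  split_ifs with h
  · have hk : k ∈ S := h.1
    rw [ha.apply_of_isLeast h, ha.adjoint_apply_of_lt, Finset.insert_erase hk, inner_eS_left]
    intro t ht
    rw [Finset.mem_erase] at ht
    exact lt_of_le_of_ne (h.2 ht.2) ht.1.symm
  · rw [ha.apply_of_not_isLeast h, map_zero, inner_zero_left]

open Classical in
theorem IsMonotoneAnnihilation.apply_adjoint_self_apply {a : ℤ → MF →L[ℂ] MF}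
    (ha : IsMonotoneAnnihilation a) (i : ℤ) (ξ : MF) (S : Finset ℤ) :
    a i (adjoint (a i) ξ) S = if ∀ t ∈ S, i < t then ξ S else 0 := by
  rw [← inner_eS_left S, ← adjoint_inner_left, adjoint_inner_right]
  split_ifs with h
  · have hi : i ∉ S := fun hS => lt_irrefl _ (h i hS)
    rw [ha.adjoint_apply_of_lt h, ha.apply_of_isLeast, Finset.erase_insert hi, inner_eS_left]
    refine ⟨by simp, fun t ht => ?_⟩
    rcases Finset.mem_insert.1 (Finset.mem_coe.1 ht) with rfl | ht
    exacts [le_rfl, (h t ht).le]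
  · rw [ha.adjoint_apply_of_not_lt h, map_zero, inner_zero_left]

theorem IsMonotoneAnnihilation.comp_adjoint_of_ne {a : ℤ → MF →L[ℂ] MF}
    (ha : IsMonotoneAnnihilation a) {i j : ℤ} (hij : i ≠ j) :
    (a i).comp (adjoint (a j)) = 0 := by
  ext ξ S
  change a i (adjoint (a j) ξ) S = 0
  rw [← inner_eS_left S, ← adjoint_inner_left, adjoint_inner_right]
  by_cases h : ∀ t ∈ S, i < t
  · rw [ha.adjoint_apply_of_lt h, ha.apply_of_not_isLeast, inner_zero_left]
    intro hj
    refine hij (IsLeast.unique ⟨by simp, fun t ht => ?_⟩ hj)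
    rcases Finset.mem_insert.1 (Finset.mem_coe.1 ht) with rfl | ht
    exacts [le_rfl, (h t ht).le]
  · rw [ha.adjoint_apply_of_not_lt h, map_zero, inner_zero_left]

open Classical in
theorem hasSum_of_apply_eq_ite {γ : Type*} (g : Finset ℤ → γ) (η : MF) (ζ : γ → MF)
    (hζ : ∀ c S, ζ c S = if g S = c then η S else 0) : HasSum ζ η := by
  have hsum := (lp.hasSum_single (p := 2) (by simp) η).tsum_fiberwise g
  convert hsum using 1
  funext c
  have hc := lp.hasSum_single (p := 2) (by simp) (ζ c)
  rw [← hasSum_subtype_iff_of_support_subset (s := g ⁻¹' {c})] at hc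
  · rw [← hc.tsum_eq]
    refine tsum_congr fun S => ?_
    have hS : g S = c := S.2
    simp [hζ, hS]
  · intro S hS
    by_contra hne
    have hne' : g S ≠ c := hne
    exact hS (by simp [hζ, hne'])

theorem IsMonotoneAnnihilation.hasSum_adjoint_apply_self {a : ℤ → MF →L[ℂ] MF}
    (ha : IsMonotoneAnnihilation a) (i : ℤ) (ξ : MF) :
    HasSum (fun k : {k : ℤ // k ≤ i} => adjoint (a k) (a k ξ))
      (ξ - a i (adjoint (a i) ξ)) := by
  classical
  let g : Finset ℤ → {k : ℤ // k ≤ i} := fun S =>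
    if h : ∃ k : {k : ℤ // k ≤ i}, IsLeast (S : Set ℤ) k then h.choose else ⟨i, le_rfl⟩
  refine hasSum_of_apply_eq_ite g _ _ fun k S => ?_
  rw [ha.adjoint_apply_self_apply, lp.coeFn_sub, Pi.sub_apply, ha.apply_adjoint_self_apply]
  by_cases h : ∃ k : {k : ℤ // k ≤ i}, IsLeast (S : Set ℤ) k
  · have hg : IsLeast (S : Set ℤ) (g S) := by
      simp only [g, dif_pos h]
      exact h.choose_spec
    have hlt : ¬ ∀ t ∈ S, i < t := fun hS => (hS _ hg.1).not_ge (g S).2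
    have hiff : IsLeast (S : Set ℤ) k ↔ g S = k :=
      ⟨fun hk => Subtype.ext (hg.unique hk), fun hk => hk ▸ hg⟩
    simp only [hiff, if_neg hlt, sub_zero]
  · have hlt : ∀ t ∈ S, i < t := by
      intro t ht
      by_contra hti
      have hmin := S.isLeast_min' ⟨t, ht⟩
      exact h ⟨⟨_, (hmin.2 ht).trans (not_lt.1 hti)⟩, hmin⟩
    rw [if_neg fun hk => h ⟨k, hk⟩, if_pos hlt, sub_self, ite_self]

/-- `a_i a_j† = δ_{i,j} (I - Σ_{k ≤ i} a_k† a_k)`, with strong convergence of the series. -/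
theorem stmt1 (a : ℤ → MF →L[ℂ] MF) (ha : IsMonotoneAnnihilation a) :
    (∀ i j : ℤ, i ≠ j → (a i).comp (adjoint (a j)) = 0) ∧
    (∀ (i : ℤ) (ξ : MF),
      HasSum (fun k : {k : ℤ // k ≤ i} => adjoint (a k) (a k ξ))
        (ξ - a i (adjoint (a i) ξ))) := by
  exact ⟨fun _ _ => ha.comp_adjoint_of_ne, ha.hasSum_adjoint_apply_self⟩
end
end

section
/- For all integers i, j, one has a_i a_i† a_j = a_j − Σ_{k=j+1}^{i} a_k† a_k a_j (a finite sum over the integers k with j < k ≤ i) if i > j, and a_i a_i† a_j = a_j if i ≤ j (monotone rule (3.4)). -/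
noncomputable section

open ContinuousLinearMap

lemma Finset.lt_min_erase {α : Type*} [LinearOrder α] {i : α} {S : Finset α}
    (h : S.min = (i : WithTop α)) : (i : WithTop α) < (S.erase i).min := by
  refine lt_of_le_of_ne (h ▸ Finset.min_mono (Finset.erase_subset i S)) fun h' => ?_
  exact Finset.notMem_erase i S (Finset.mem_of_min h'.symm)

/-- The vectors `eS S` separate bounded operators on the monotone Fock space. -/
lemma MF.clm_ext {f g : MF →L[ℂ] MF} (h : ∀ S, f (eS S) = g (eS S)) : f = g := by
  refine lp.ext_continuousLinearMap (by simp) fun S => ?_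
  ext1
  simpa [eS] using h S

/-- A vector of the monotone Fock space is determined by its inner products with the `eS S`. -/
lemma MF.ext_inner_eS {x y : MF} (h : ∀ S, inner ℂ (eS S) x = inner ℂ (eS S) y) : x = y := by
  refine lp.ext (funext fun S => ?_)
  simpa [eS, lp.inner_single_left] using h S

lemma inner_eS (S T : Finset ℤ) : inner ℂ (eS S) (eS T) = if S = T then (1 : ℂ) else 0 := by
  simp [eS, lp.inner_single_left, lp.single_apply, Pi.single_apply]

namespace IsMonotoneAnnihilation

variable {a : ℤ → MF →L[ℂ] MF}

lemma apply_of_min_eq (ha : IsMonotoneAnnihilation a) {i : ℤ} {S : Finset ℤ}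
    (h : S.min = (i : WithTop ℤ)) :
    a i (eS S) = eS (S.erase i) := (ha i S).1 h

lemma apply_of_min_ne (ha : IsMonotoneAnnihilation a) {i : ℤ} {S : Finset ℤ}
    (h : S.min ≠ (i : WithTop ℤ)) :
    a i (eS S) = 0 := (ha i S).2 h

lemma apply_insert (ha : IsMonotoneAnnihilation a) {i : ℤ} {S : Finset ℤ}
    (h : (i : WithTop ℤ) < S.min) :
    a i (eS (insert i S)) = eS S := by
  have hi : i ∉ S := fun hi => (Finset.min_le hi).not_gt h
  rw [ha.apply_of_min_eq (by rw [Finset.min_insert, min_eq_left h.le]), Finset.erase_insert hi]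

lemma adjoint_apply_of_lt_s5 (ha : IsMonotoneAnnihilation a) {i : ℤ} {S : Finset ℤ}
    (h : (i : WithTop ℤ) < S.min) :
    adjoint (a i) (eS S) = eS (insert i S) := by
  refine MF.ext_inner_eS fun T => ?_
  rw [adjoint_inner_right, inner_eS]
  by_cases hT : T.min = (i : WithTop ℤ)
  · have hi : i ∉ S := fun hi => (Finset.min_le hi).not_gt h
    rw [ha.apply_of_min_eq hT, inner_eS]
    simp only [Finset.erase_eq_iff_eq_insert (Finset.mem_of_min hT) hi]
  · rw [ha.apply_of_min_ne hT, inner_zero_left, if_neg]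
    rintro rfl
    exact hT (by rw [Finset.min_insert, min_eq_left h.le])

lemma adjoint_apply_of_not_lt_s5 (ha : IsMonotoneAnnihilation a) {i : ℤ} {S : Finset ℤ}
    (h : ¬ (i : WithTop ℤ) < S.min) :
    adjoint (a i) (eS S) = 0 := by
  refine MF.ext_inner_eS fun T => ?_
  rw [adjoint_inner_right, inner_zero_right]
  by_cases hT : T.min = (i : WithTop ℤ)
  · rw [ha.apply_of_min_eq hT, inner_eS, if_neg]
    rintro rfl
    exact h (Finset.lt_min_erase hT)
  · rw [ha.apply_of_min_ne hT, inner_zero_left]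

/-- `a i * (a i)†` is the projection onto the span of the `eS S` with `i < min S`. -/
lemma apply_adjoint_apply (ha : IsMonotoneAnnihilation a) (i : ℤ) (S : Finset ℤ) :
    a i (adjoint (a i) (eS S)) = if (i : WithTop ℤ) < S.min then eS S else 0 := by
  split_ifs with h
  · rw [ha.adjoint_apply_of_lt_s5 h, ha.apply_insert h]
  · rw [ha.adjoint_apply_of_not_lt_s5 h, map_zero]

/-- `(a k)† * a k` is the projection onto the span of the `eS S` with `min S = k`. -/
lemma adjoint_apply_apply (ha : IsMonotoneAnnihilation a) (k : ℤ) (S : Finset ℤ) :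
    adjoint (a k) (a k (eS S)) = if S.min = (k : WithTop ℤ) then eS S else 0 := by
  split_ifs with h
  · rw [ha.apply_of_min_eq h, ha.adjoint_apply_of_lt_s5 (Finset.lt_min_erase h),
      Finset.insert_erase (Finset.mem_of_min h)]
  · rw [ha.apply_of_min_ne h, map_zero]

end IsMonotoneAnnihilation

/-- Monotone rule (3.4): `a_i a_i† a_j = a_j − Σ_{j<k≤i} a_k† a_k a_j` if `i > j`,
and `a_i a_i† a_j = a_j` if `i ≤ j`. -/
theorem stmt5 (a : ℤ → MF →L[ℂ] MF) (ha : IsMonotoneAnnihilation a)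
    (i j : ℤ) :
    (i > j → ((a i).comp (adjoint (a i))).comp (a j) =
      a j - ∑ k ∈ Finset.Icc (j + 1) i, ((adjoint (a k)).comp (a k)).comp (a j)) ∧
    (i ≤ j → ((a i).comp (adjoint (a i))).comp (a j) = a j) := by
  have key : ∀ S : Finset ℤ, (j : WithTop ℤ) < S.min →
      a i (adjoint (a i) (eS S)) =
        eS S - ∑ k ∈ Finset.Icc (j + 1) i, adjoint (a k) (a k (eS S)) := by
    intro S hS
    simp only [ha.apply_adjoint_apply, ha.adjoint_apply_apply]
    induction hm : S.min using WithTop.recTopCoe with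
    | top => simp
    | coe m =>
      have hjm : j < m := by rwa [hm, WithTop.coe_lt_coe] at hS
      simp only [WithTop.coe_lt_coe, WithTop.coe_inj, Finset.sum_ite_eq, Finset.mem_Icc]
      by_cases h : i < m
      · simp [h, h.not_ge]
      · simp [h, not_lt.1 h, Int.add_one_le_of_lt hjm]
  have main : ((a i).comp (adjoint (a i))).comp (a j) =
      a j - ∑ k ∈ Finset.Icc (j + 1) i, ((adjoint (a k)).comp (a k)).comp (a j) := by
    refine MF.clm_ext fun S => ?_
    simp only [comp_apply, sub_apply, sum_apply]
    by_cases hS : S.min = (j : WithTop ℤ)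
    · rw [ha.apply_of_min_eq hS]
      exact key _ (Finset.lt_min_erase hS)
    · simp [ha.apply_of_min_ne hS]
  refine ⟨fun _ => main, fun h => ?_⟩
  rw [main, Finset.Icc_eq_empty (by lia), Finset.sum_empty, sub_zero]
end
end
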